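/- For every integer d ≥ 1 there is a constant C = C(d) such that the following holds. Let k ≥ 0 be an integer and let A ⊂ ℝ be a union of β closed dyadic intervals of length 2^{−k}. Then for every x ∈ ℝ^d and r ∈ [1,2]^d, the number of cubes Q ∈ 𝒬_k such that Q ∩ L_{x,r} ∩ (A × ℝ^{d−1}) ≠ ∅ is at most Cβ. -/

import Mathlib

open MeasureTheory Set

/-- The line `L_{x,r} = {((z-x_1)/r_1, …, (z-x_d)/r_d) : z ∈ ℝ} ⊂ ℝ^d`. -/
def line (d : ℕ) (x r : Fin d → ℝ) : Set (Fin d → ℝ) :=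
  {y | ∃ z : ℝ, ∀ i, y i = (z - x i) / r i}

/-- The dyadic cube of generation `k` indexed by `q : Fin d → ℤ`. -/
def dyadicCube (d k : ℕ) (q : Fin d → ℤ) : Set (Fin d → ℝ) :=
  univ.pi fun i => Icc ((q i : ℝ) / 2 ^ k) (((q i : ℝ) + 1) / 2 ^ k)

/-- On a line with directions in `[1, 2]`, the `i`-th index of a dyadic cube takes one of four values
once the dyadic interval containing the coordinate `i₀` is fixed. -/
theorem index_mem_Icc_of_line {N z x₀ r₀ xᵢ rᵢ : ℝ} {j q : ℤ} (hN : 0 < N)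
    (hr₀ : r₀ ∈ Icc (1 : ℝ) 2) (hrᵢ : rᵢ ∈ Icc (1 : ℝ) 2)
    (hj : (z - x₀) / r₀ ∈ Icc ((j : ℝ) / N) (((j : ℝ) + 1) / N))
    (hq : (z - xᵢ) / rᵢ ∈ Icc ((q : ℝ) / N) (((q : ℝ) + 1) / N)) :
    q ∈ Finset.Icc (⌊(r₀ * j + N * (x₀ - xᵢ)) / rᵢ⌋ - 1)
      (⌊(r₀ * j + N * (x₀ - xᵢ)) / rᵢ⌋ + 2) := by
  obtain ⟨h1, h2⟩ := hr₀
  obtain ⟨h3, h4⟩ := hrᵢ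
  obtain ⟨hj1, hj2⟩ := hj
  obtain ⟨hq1, hq2⟩ := hq
  have hr₀ : 0 < r₀ := by linarith
  have hrᵢ : 0 < rᵢ := by linarith
  rw [div_le_div_iff₀ (by assumption) (by assumption)] at hj1 hj2 hq1 hq2
  rw [Finset.mem_Icc]
  constructor
  · have h : (r₀ * j + N * (x₀ - xᵢ)) / rᵢ ≤ q + 1 := by
      rw [div_le_iff₀ hrᵢ]
      linarith
    have h' : (⌊(r₀ * j + N * (x₀ - xᵢ)) / rᵢ⌋ : ℝ) ≤ q + 1 := (Int.floor_le _).trans h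
    have : ⌊(r₀ * j + N * (x₀ - xᵢ)) / rᵢ⌋ ≤ q + 1 := by exact_mod_cast h'
    linarith
  · have h : ((q - 2 : ℤ) : ℝ) ≤ (r₀ * j + N * (x₀ - xᵢ)) / rᵢ := by
      rw [le_div_iff₀ hrᵢ]
      push_cast
      linarith
    have := Int.le_floor.2 h
    linarith

theorem stmt15 (d : ℕ) (hd : 1 ≤ d) :
    ∃ C : ℝ, 0 < C ∧
    ∀ (k β : ℕ) (S : Finset ℤ), S.card = β →
    ∀ A : Set ℝ, A = ⋃ j ∈ S, Icc ((j : ℝ) / 2 ^ k) (((j : ℝ) + 1) / 2 ^ k) →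
    ∀ x r : Fin d → ℝ, (∀ i, r i ∈ Icc (1 : ℝ) 2) →
      ({q : Fin d → ℤ |
        (dyadicCube d k q ∩ line d x r ∩ {y | y ⟨0, hd⟩ ∈ A}).Nonempty}).ncard ≤ C * β := by
  refine ⟨4 ^ d, by positivity, ?_⟩
  rintro k β S rfl A rfl x r hr
  set T : ℤ → Finset (Fin d → ℤ) := fun j => Fintype.piFinset fun i =>
    Finset.Icc (⌊(r ⟨0, hd⟩ * j + 2 ^ k * (x ⟨0, hd⟩ - x i)) / r i⌋ - 1)
      (⌊(r ⟨0, hd⟩ * j + 2 ^ k * (x ⟨0, hd⟩ - x i)) / r i⌋ + 2) with hT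
  have hcard : ∀ j, (T j).card = 4 ^ d := by
    intro j
    have h : ∀ n : ℤ, (Finset.Icc (n - 1) (n + 2)).card = 4 := by
      intro n
      rw [Int.card_Icc]
      omega
    simp [hT, Fintype.card_piFinset, -Int.card_Icc, h]
  have hsub : {q : Fin d → ℤ | (dyadicCube d k q ∩ line d x r ∩
      {y | y ⟨0, hd⟩ ∈ ⋃ j ∈ S, Icc ((j : ℝ) / 2 ^ k) (((j : ℝ) + 1) / 2 ^ k)}).Nonempty} ⊆
      (S.biUnion T : Finset (Fin d → ℤ)) := by
    rintro q ⟨y, ⟨hyq, z, hz⟩, hyA⟩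
    obtain ⟨j, hjS, hj⟩ := mem_iUnion₂.1 hyA
    rw [hz] at hj
    refine Finset.mem_coe.2 (Finset.mem_biUnion.2 ⟨j, hjS, Fintype.mem_piFinset.2 fun i => ?_⟩)
    have hq := hyq i (mem_univ i)
    simp only [hz] at hq
    exact index_mem_Icc_of_line (by positivity) (hr _) (hr i) hj hq
  have hle : _ ≤ S.card * 4 ^ d :=
    (ncard_le_ncard hsub (Finset.finite_toSet _)).trans <| by
      rw [ncard_coe_finset]
      exact Finset.card_biUnion_le_card_mul S T _ fun j _ => (hcard j).le
  rw [mul_comm]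
  exact_mod_cast hle
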